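/- Let k ≥ 3 be an integer, let G be a weighted multigraph on a vertex set V with |V| = n ≥ k, let ε ∈ (0, 1/k) be real, and let j : V → V → ℝ be a symmetric nonnegative function with j(v,v) = 0 and j(u,v) ≤ w(u,v) for all u,v. Let α ≥ 0 be a real with (1/2)∑_{u,v} j(u,v) ≤ α·λ_k, and set λ̄_k = λ_k/k and β = k + 2αk/ε. Call a subset S with ∅ ≠ S ⊊ V a good cut if it is a medium cut (λ_k/(k−1) ≤ ∂S < 2λ_k/k) and moreover ∂S − ∂_j S ≥ (1−ε)·(k/(k−1))·λ̄_k, where ∂_j S = ∑_{u∈S, v∉S} j(u,v). Let s be the number of good cuts. Then the total edge weight m satisfies m ≥ (n − β)·λ̄_k − min{s, n−β}·λ̄_k/2. -/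

import Mathlib

open Finset

/-- The weight of a `k`-cut, viewed as a finite partition `P` of the vertex set:
the sum of `w u v` over unordered pairs `{u, v}` lying in different parts. -/
noncomputable def kCutWeight {V : Type*} [Fintype V] [DecidableEq V] (w : V → V → ℝ)
    (P : Finpartition (univ : Finset V)) : ℝ :=
  (1 / 2) * ∑ u, ∑ v, if ∃ p ∈ P.parts, u ∈ p ∧ v ∈ p then (0 : ℝ) else w u v

/-- The weight `∂S` of the 2-cut with shore `S`, with respect to an edge-weight
function `w`. -/
noncomputable def cutW {V : Type*} [Fintype V] [DecidableEq V] (w : V → V → ℝ)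
    (S : Finset V) : ℝ :=
  ∑ u ∈ S, ∑ v ∈ Sᶜ, w u v

/-- The 2-cut around a single vertex is its weighted degree. -/
lemma cutW_singleton {V : Type*} [Fintype V] [DecidableEq V] (w : V → V → ℝ)
    (hdiag : ∀ v, w v v = 0) (v : V) : cutW w {v} = ∑ u, w v u := by
  rw [cutW, sum_singleton, ← sum_add_sum_compl {v} (w v), sum_singleton, hdiag, zero_add]

lemma kCutWeight_nonneg {V : Type*} [Fintype V] [DecidableEq V] {w : V → V → ℝ}
    (hnonneg : ∀ u v, 0 ≤ w u v) (P : Finpartition (univ : Finset V)) :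
    0 ≤ kCutWeight w P := by
  refine mul_nonneg (by norm_num) (sum_nonneg fun u _ => sum_nonneg fun v _ => ?_)
  split_ifs
  exacts [le_rfl, hnonneg u v]

/-- Isolating the vertices of a proper subset `T` gives a cut into `#T + 1` parts whose weight is
at most the sum of the degrees in `T`. -/
lemma exists_kCut_isolating {V : Type*} [Fintype V] [DecidableEq V] {w : V → V → ℝ}
    (hsymm : ∀ u v, w u v = w v u) (hnonneg : ∀ u v, 0 ≤ w u v)
    (T : Finset V) (hT : Tᶜ.Nonempty) :
    ∃ P : Finpartition (univ : Finset V), P.parts.card = T.card + 1 ∧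
      kCutWeight w P ≤ ∑ v ∈ T, ∑ u, w v u := by
  let P : Finpartition (univ : Finset V) :=
    (⊥ : Finpartition T).extend hT.ne_empty disjoint_compl_right (sup_compl_eq_top (x := T))
  refine ⟨P, ?_, ?_⟩
  · rw [Finpartition.card_extend, Finpartition.card_bot]
  have hle : ∀ u v, (if ∃ p ∈ P.parts, u ∈ p ∧ v ∈ p then (0 : ℝ) else w u v) ≤
      (if u ∈ T then w u v else 0) + (if v ∈ T then w u v else 0) := by
    intro u v
    have := hnonneg u v
    by_cases hu : u ∈ T
    · split_ifs <;> linarith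
    by_cases hv : v ∈ T
    · split_ifs <;> linarith
    · rw [if_pos ⟨Tᶜ, by simp [P], by simpa using hu, by simpa using hv⟩]
      simp [hu, hv]
  have hsum := sum_le_sum fun u (_ : u ∈ univ) => sum_le_sum fun v (_ : v ∈ univ) => hle u v
  have h₁ : ∑ u, ∑ v, (if u ∈ T then w u v else 0) = ∑ v ∈ T, ∑ u, w v u := by
    rw [← univ_inter T, ← sum_ite_mem]
    exact sum_congr rfl fun u _ => by by_cases hu : u ∈ T <;> simp [hu]
  have h₂ : ∑ u, ∑ v, (if v ∈ T then w u v else 0) = ∑ v ∈ T, ∑ u, w v u := by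
    rw [sum_comm, ← h₁]
    simp only [hsymm]
  simp only [sum_add_distrib] at hsum
  rw [h₁, h₂] at hsum
  rw [kCutWeight]
  linarith

/-- Fewer than `k - 1` vertices have degree below `λ_k / (k - 1)`. -/
lemma card_small_degree_lt {V : Type*} [Fintype V] [DecidableEq V] {w : V → V → ℝ} {k : ℕ}
    {lam : ℝ} (hk : 2 ≤ k) (hn : k ≤ Fintype.card V)
    (hsymm : ∀ u v, w u v = w v u) (hnonneg : ∀ u v, 0 ≤ w u v)
    (hmin : ∀ P : Finpartition (univ : Finset V), P.parts.card = k → lam ≤ kCutWeight w P) :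
    (univ.filter fun v => ∑ u, w v u < lam / ((k : ℝ) - 1)).card < k - 1 := by
  by_contra! hcard
  obtain ⟨T, hTA, hTk⟩ := exists_subset_card_eq hcard
  have hTc : Tᶜ.Nonempty := by
    rw [← card_pos, card_compl]
    omega
  obtain ⟨P, hP, hPw⟩ := exists_kCut_isolating hsymm hnonneg T hTc
  have hTne : T.Nonempty := by
    rw [← card_pos]
    omega
  have hlt : ∑ v ∈ T, ∑ u, w v u < ∑ _v ∈ T, lam / ((k : ℝ) - 1) :=
    sum_lt_sum_of_nonempty hTne fun v hv => (mem_filter.mp (hTA hv)).2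
  have hk1 : (0 : ℝ) < (k : ℝ) - 1 := by
    have : (2 : ℝ) ≤ k := by exact_mod_cast hk
    linarith
  rw [sum_const, hTk, nsmul_eq_mul, Nat.cast_sub (by omega), Nat.cast_one,
    mul_div_cancel₀ _ hk1.ne'] at hlt
  linarith [hmin P (by omega)]

/-- With at least three vertices, distinct vertices give distinct singleton 2-cuts. -/
lemma pair_singleton_compl_injective {V : Type*} [Fintype V] [DecidableEq V]
    (hV : 3 ≤ Fintype.card V) :
    Function.Injective fun v : V => ({{v}, {v}ᶜ} : Finset (Finset V)) := by
  intro a b hab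
  have hmem : ({a} : Finset V) ∈ ({{b}, {b}ᶜ} : Finset (Finset V)) := by
    rw [← show ({{a}, {a}ᶜ} : Finset (Finset V)) = {{b}, {b}ᶜ} from hab]
    simp
  rw [mem_insert, mem_singleton] at hmem
  rcases hmem with h | h
  · exact singleton_injective h
  · have := congrArg card h
    rw [card_compl, card_singleton, card_singleton] at this
    omega

/-- If `G` has `s` good cuts, then the total edge weight `m` satisfies
`m ≥ (n − β)·λ̄_k − min{s, n−β}·λ̄_k/2`, where `β = k + 2αk/ε` and `λ̄_k = λ_k/k`.  A good
cut is a medium cut `S` with `∂S − ∂_j S ≥ (1−ε)·(k/(k−1))·λ̄_k`, where `j` models an edge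
subset `J` of total weight at most `α·λ_k`. -/
theorem edge_count_with_good_cuts_crude (k : ℕ) (hk : 3 ≤ k)
    (V : Type) [Fintype V] [DecidableEq V] (w : V → V → ℝ) (lam : ℝ)
    (ε α : ℝ) (j : V → V → ℝ)
    (hn : k ≤ Fintype.card V)
    (hsymm : ∀ u v, w u v = w v u)
    (hnonneg : ∀ u v, 0 ≤ w u v)
    (hdiag : ∀ v, w v v = 0)
    (hex : ∃ P : Finpartition (univ : Finset V), P.parts.card = k ∧ kCutWeight w P = lam)
    (hmin : ∀ P : Finpartition (univ : Finset V), P.parts.card = k → lam ≤ kCutWeight w P)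
    (hε0 : 0 < ε) (hεk : ε < 1 / k)
    (hjsymm : ∀ u v, j u v = j v u)
    (hjnonneg : ∀ u v, 0 ≤ j u v)
    (hjdiag : ∀ v, j v v = 0)
    (hjw : ∀ u v, j u v ≤ w u v)
    (hα : 0 ≤ α)
    (hJ : (1 / 2) * ∑ u, ∑ v, j u v ≤ α * lam)
    (s : ℕ)
    (hs : s = {p : Finset (Finset V) | ∃ S : Finset V, p = {S, Sᶜ} ∧
        S.Nonempty ∧ Sᶜ.Nonempty ∧
        lam / ((k : ℝ) - 1) ≤ cutW w S ∧ cutW w S < 2 * lam / k ∧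
        (1 - ε) * ((k : ℝ) / ((k : ℝ) - 1)) * (lam / k) ≤ cutW w S - cutW j S}.ncard) :
    ((Fintype.card V : ℝ) - ((k : ℝ) + 2 * α * k / ε)) * (lam / k) -
        min (s : ℝ) ((Fintype.card V : ℝ) - ((k : ℝ) + 2 * α * k / ε)) * (lam / k) / 2 ≤
      (1 / 2) * ∑ u, ∑ v, w u v := by
  have hkR : (3 : ℝ) ≤ k := by exact_mod_cast hk
  have hk1 : (0 : ℝ) < (k : ℝ) - 1 := by linarith
  have hlam : 0 ≤ lam := by
    obtain ⟨P, -, rfl⟩ := hex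
    exact kCutWeight_nonneg hnonneg P
  set L := lam / (k : ℝ) with hL
  have hL0 : 0 ≤ L := by positivity
  have hlamL : lam = k * L := by rw [hL]; field_simp
  rcases hL0.eq_or_lt with hL00 | hLpos
  · rw [← hL00]
    have := sum_nonneg fun u (_ : u ∈ univ) => sum_nonneg fun v (_ : v ∈ univ) => hnonneg u v
    linarith
  have hratio : 1 ≤ (k : ℝ) / ((k : ℝ) - 1) := by rw [le_div_iff₀ hk1]; linarith
  have hmed : lam / ((k : ℝ) - 1) = (k : ℝ) / ((k : ℝ) - 1) * L := by rw [hlamL]; ring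
  have hmedL : L ≤ lam / ((k : ℝ) - 1) := by rw [hmed]; nlinarith
  let d : V → ℝ := fun v => ∑ u, w v u
  let dj : V → ℝ := fun v => ∑ u, j v u
  have hdj0 : ∀ v, 0 ≤ dj v := fun v => sum_nonneg fun u _ => hjnonneg v u
  have hd0 : ∀ v, 0 ≤ d v := fun v => sum_nonneg fun u _ => hnonneg v u
  let small : Finset V := {v | d v < lam / ((k : ℝ) - 1)}
  let bad : Finset V := {v | lam / ((k : ℝ) - 1) ≤ d v ∧
    d v - dj v < (1 - ε) * ((k : ℝ) / ((k : ℝ) - 1)) * L}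
  let good : Finset V := {v | lam / ((k : ℝ) - 1) ≤ d v ∧ d v < 2 * lam / k ∧
    (1 - ε) * ((k : ℝ) / ((k : ℝ) - 1)) * L ≤ d v - dj v}
  have hsmall : (small.card : ℝ) ≤ k := by
    have := card_small_degree_lt (by omega) hn hsymm hnonneg hmin
    exact Nat.cast_le.mpr (this.le.trans (Nat.sub_le k 1))
  have hbad : (bad.card : ℝ) ≤ 2 * α * k / ε := by
    have hle : ∑ v, (if v ∈ bad then ε * L else 0) ≤ ∑ v, dj v := by
      refine sum_le_sum fun v _ => ?_
      split_ifs with h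
      · obtain ⟨h₁, h₂⟩ := (mem_filter.mp h).2
        rw [hmed] at h₁
        have : ε * L ≤ (k : ℝ) / ((k : ℝ) - 1) * (ε * L) :=
          le_mul_of_one_le_left (by positivity) hratio
        linarith
      · exact hdj0 v
    rw [sum_ite_mem, univ_inter, sum_const, nsmul_eq_mul] at hle
    rw [le_div_iff₀ hε0]
    have hJ' : ∑ v, dj v ≤ 2 * α * k * L := by
      rw [hlamL] at hJ
      linarith
    exact le_of_mul_le_mul_right (by linarith) hLpos
  have hgood : (good.card : ℝ) ≤ s := by
    rw [hs, Nat.cast_le,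
      ← card_image_of_injective _ (pair_singleton_compl_injective (V := V) (by omega)),
      ← Set.ncard_coe_finset]
    refine Set.ncard_le_ncard ?_ (Set.toFinite _)
    intro p hp
    obtain ⟨v, hv, rfl⟩ := mem_image.mp (mem_coe.mp hp)
    refine ⟨{v}, rfl, singleton_nonempty v, ?_, ?_⟩
    · rw [← card_pos, card_compl, card_singleton]
      omega
    · rw [cutW_singleton w hdiag, cutW_singleton j hjdiag]
      exact (mem_filter.mp hv).2
  have hvertex : ∀ v, 2 * L ≤ d v + (if v ∈ small then 2 * L else 0) +
      (if v ∈ bad then 2 * L else 0) + (if v ∈ good then L else 0) := by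
    intro v
    have := hd0 v
    have h2 : 2 * lam / k = 2 * L := by rw [hL]; ring
    by_cases h₁ : v ∈ small
    · rw [if_pos h₁]
      split_ifs <;> linarith
    by_cases h₂ : v ∈ bad
    · rw [if_pos h₂]
      split_ifs <;> linarith
    by_cases h₃ : v ∈ good
    · rw [if_neg h₁, if_neg h₂, if_pos h₃]
      linarith [(mem_filter.mp h₃).2.1]
    · rw [if_neg h₁, if_neg h₂, if_neg h₃]
      have h₄ : lam / ((k : ℝ) - 1) ≤ d v := not_lt.mp fun h => h₁ (by simpa [small] using h)
      have h₅ : (1 - ε) * ((k : ℝ) / ((k : ℝ) - 1)) * L ≤ d v - dj v :=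
        not_lt.mp fun h => h₂ (mem_filter.mpr ⟨mem_univ v, h₄, h⟩)
      have h₆ : 2 * lam / k ≤ d v := not_lt.mp fun h => h₃ (mem_filter.mpr ⟨mem_univ v, h₄, h, h₅⟩)
      linarith
  have hsum := sum_le_sum fun v (_ : v ∈ univ) => hvertex v
  simp only [sum_add_distrib, sum_ite_mem, univ_inter, sum_const, nsmul_eq_mul, card_univ] at hsum
  have hgood_le : ∑ v, (if v ∈ good then L else 0) ≤ ∑ v, d v := by
    refine sum_le_sum fun v _ => ?_
    split_ifs with h
    exacts [hmedL.trans (mem_filter.mp h).2.1, hd0 v]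
  rw [sum_ite_mem, univ_inter, sum_const, nsmul_eq_mul] at hgood_le
  have hA := mul_le_mul_of_nonneg_right hsmall hL0
  have hB := mul_le_mul_of_nonneg_right hbad hL0
  have hG := mul_le_mul_of_nonneg_right hgood hL0
  change _ ≤ (1 / 2) * ∑ v, d v
  rcases min_choice (s : ℝ) ((Fintype.card V : ℝ) - ((k : ℝ) + 2 * α * k / ε)) with h | h <;>
  · rw [h]
    linarith
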